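/- arXiv:1904.12767 — 8 statements merged into one kernel-verified Lean document; each statement's English description precedes it below -/
import Mathlib

section
/- The function p̃_n is M-convex on the discrete simplex: for any d, d' ∈ ℕ₀ⁿ with Σ_{k=1}^n d(k) = Σ_{k=1}^n d'(k) = b_n and any i ∈ [n] with d(i) > d'(i), there exists j ∈ [n] with d'(j) > d(j) such that p̃_n(d − e_i + e_j) + p̃_n(d' + e_i − e_j) ≤ p̃_n(d) + p̃_n(d'), where e_i denotes the i-th standard basis vector (and the modified vectors again lie in ℕ₀ⁿ with coordinate sum b_n). -/
open scoped Classical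

/-- `p̃_n(d) = Σ_i (d_in^A(i)/(d_in^A(i)+d(i)))·(d_out(i)/m_n)` where `m_n = Σ_i d_out(i)`. -/
noncomputable def ptilde (n : ℕ) (dout din : Fin n → ℕ) (d : Fin n → ℝ) : ℝ :=
  ∑ i, ((din i : ℝ) / ((din i : ℝ) + d i)) * ((dout i : ℝ) / (∑ j, (dout j : ℝ)))

lemma aux_conv (a x y : ℝ) (ha : 0 < a) (hy : 0 ≤ y) (hxy : y + 1 ≤ x) :
    a / (a + (x - 1)) + a / (a + (y + 1)) ≤ a / (a + x) + a / (a + y) := by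
  have hP : 0 < a + (x - 1) := by linarith
  have hQ : 0 < a + y := by linarith
  have h1 : a / (a + (x - 1)) - a / (a + x) = a / ((a + (x - 1)) * (a + x)) := by
    have : a + x ≠ 0 := by linarith
    field_simp
    ring
  have h2 : a / (a + y) - a / (a + (y + 1)) = a / ((a + y) * (a + (y + 1))) := by
    have : a + (y + 1) ≠ 0 := by linarith
    field_simp
    ring
  have h3 : a / ((a + (x - 1)) * (a + x)) ≤ a / ((a + y) * (a + (y + 1))) := by
    apply div_le_div_of_nonneg_left ha.le
    · have : 0 < a + (y + 1) := by linarith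
      positivity
    · apply mul_le_mul <;> linarith
  linarith

/-- `p̃_n` is M-convex on the discrete simplex. -/
theorem stmt2 (n b : ℕ) (hn : 0 < n) (hb : 0 < b)
    (dout din : Fin n → ℕ) (hdout : ∀ i, 0 < dout i) (hdin : ∀ i, 0 < din i)
    (d d' : Fin n → ℕ) (hd : ∑ k, d k = b) (hd' : ∑ k, d' k = b)
    (i : Fin n) (hi : d' i < d i) :
    ∃ j : Fin n, d j < d' j ∧
      ptilde n dout din
          (fun k => (d k : ℝ) - (if k = i then 1 else 0) + (if k = j then 1 else 0))
        + ptilde n dout din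
          (fun k => (d' k : ℝ) + (if k = i then 1 else 0) - (if k = j then 1 else 0))
      ≤ ptilde n dout din (fun k => (d k : ℝ))
        + ptilde n dout din (fun k => (d' k : ℝ)) := by
  have hj : ∃ j, d j < d' j := by
    by_contra! h
    have : ∑ k, d' k < ∑ k, d k :=
      Finset.sum_lt_sum (fun k _ => h k) ⟨i, Finset.mem_univ i, hi⟩
    omega
  obtain ⟨j, hj⟩ := hj
  refine ⟨j, hj, ?_⟩
  have hij : i ≠ j := by
    rintro rfl
    omega
  unfold ptilde
  rw [← Finset.sum_add_distrib, ← Finset.sum_add_distrib]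
  apply Finset.sum_le_sum
  intro k _
  rw [← add_mul, ← add_mul]
  apply mul_le_mul_of_nonneg_right _ (by positivity)
  have ha : (0 : ℝ) < din k := by exact_mod_cast hdin k
  by_cases hki : k = i
  · subst hki
    simp only [if_true, if_neg hij, add_zero, sub_zero]
    exact aux_conv _ _ _ ha (by positivity) (by exact_mod_cast hi)
  · by_cases hkj : k = j
    · subst hkj
      simp only [if_true, if_neg hki, add_zero, sub_zero]
      have := aux_conv _ (d' k : ℝ) (d k : ℝ) ha (by positivity) (by exact_mod_cast hj)
      linarith
    · simp [hki, hkj]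
end

section
/- The vector d_n^rel is a global minimizer of the relaxed problem: for every d ∈ ℝⁿ with d(i) ≥ 0 for all i ∈ [n] and Σ_{i=1}^n d(i) ≤ b_n, one has p̃_n(d_n^rel) ≤ p̃_n(d). -/
open scoped Classical

/-- `h(x) = (Σ_{i : r(i) ≥ x²} √(d_out(i)·d_in^A(i))) / (b_n + Σ_{i : r(i) ≥ x²} d_in^A(i))`,
where `r(i) = d_out(i)/d_in^A(i)`. -/
noncomputable def hfun (n : ℕ) (dout din : Fin n → ℕ) (b : ℕ) (x : ℝ) : ℝ :=
  (∑ i ∈ Finset.univ.filter (fun i : Fin n => x ^ 2 ≤ (dout i : ℝ) / (din i : ℝ)),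
      Real.sqrt ((dout i : ℝ) * (din i : ℝ))) /
  ((b : ℝ) + ∑ i ∈ Finset.univ.filter (fun i : Fin n => x ^ 2 ≤ (dout i : ℝ) / (din i : ℝ)),
      (din i : ℝ))

/-- `d_n^rel(i) = d_in^A(i)·max(√(r(i))/h* − 1, 0)`. -/
noncomputable def drel (n : ℕ) (dout din : Fin n → ℕ) (hstar : ℝ) (i : Fin n) : ℝ :=
  (din i : ℝ) * max (Real.sqrt ((dout i : ℝ) / (din i : ℝ)) / hstar - 1) 0

lemma term_ineq (a s H d : ℝ) (ha : 0 < a) (hs : 0 < s) (hH : 0 < H) (hd : 0 ≤ d) :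
    a / (a + a * max (s / H - 1) 0) * (a * s ^ 2) ≤
      a / (a + d) * (a * s ^ 2) + H ^ 2 * (d - a * max (s / H - 1) 0) := by
  have hu : 0 < a + d := by linarith
  rcases le_total H s with h | h
  · have h1 : 0 ≤ s / H - 1 := by
      rw [sub_nonneg, le_div_iff₀ hH]; linarith
    rw [max_eq_left h1]
    have e1 : a / (a + a * (s / H - 1)) * (a * s ^ 2) = a * s * H := by
      have : a + a * (s / H - 1) = a * s / H := by ring
      rw [this]; field_simp
    have e2 : a / (a + d) * (a * s ^ 2) + H ^ 2 * (d - a * (s / H - 1)) - a * s * H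
        = (a * s - H * (a + d)) ^ 2 / (a + d) := by
      field_simp
      ring
    have e3 : 0 ≤ (a * s - H * (a + d)) ^ 2 / (a + d) := by positivity
    rw [e1]; linarith
  · have h1 : s / H - 1 ≤ 0 := by
      rw [sub_nonpos, div_le_iff₀ hH]; linarith
    rw [max_eq_right h1]
    have e1 : a / (a + a * 0) * (a * s ^ 2) = a * s ^ 2 := by
      rw [mul_zero, add_zero, div_self ha.ne', one_mul]
    have e2 : a / (a + d) * (a * s ^ 2) + s ^ 2 * d - a * s ^ 2 = s ^ 2 * d ^ 2 / (a + d) := by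
      field_simp
      ring
    have e3 : 0 ≤ s ^ 2 * d ^ 2 / (a + d) := by positivity
    have e4 : s ^ 2 * d ≤ H ^ 2 * d := by gcongr
    rw [e1, mul_zero, sub_zero]; linarith

/-- `d_n^rel` is a global minimizer of the relaxed problem: for every `d ∈ ℝⁿ`
with nonnegative entries and `Σ_i d(i) ≤ b_n`, one has `p̃_n(d_n^rel) ≤ p̃_n(d)`. -/
theorem stmt3 (n b : ℕ) (hn : 0 < n) (hb : 0 < b)
    (dout din : Fin n → ℕ) (hdout : ∀ i, 0 < dout i) (hdin : ∀ i, 0 < din i)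
    (hstar : ℝ) (hstar_mem : ∃ x : ℝ, 0 ≤ x ∧ hfun n dout din b x = hstar)
    (hstar_max : ∀ x : ℝ, 0 ≤ x → hfun n dout din b x ≤ hstar) :
    ∀ d : Fin n → ℝ, (∀ i, 0 ≤ d i) → (∑ i, d i ≤ (b : ℝ)) →
      ptilde n dout din (drel n dout din hstar) ≤ ptilde n dout din d := by
  intro d hd hsum
  have ha : ∀ i, (0 : ℝ) < din i := fun i => by exact_mod_cast hdin i
  have ho : ∀ i, (0 : ℝ) < dout i := fun i => by exact_mod_cast hdout i
  have hbR : (0 : ℝ) < b := by exact_mod_cast hb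
  haveI : Nonempty (Fin n) := ⟨⟨0, hn⟩⟩
  have hH : 0 < hstar := by
    refine lt_of_lt_of_le ?_ (hstar_max 0 le_rfl)
    unfold hfun
    have hf : Finset.univ.filter (fun i : Fin n => (0 : ℝ) ^ 2 ≤ (dout i : ℝ) / (din i : ℝ))
        = Finset.univ := by
      apply Finset.filter_true_of_mem
      intro i _
      have := ho i
      have := ha i
      norm_num
      positivity
    rw [hf]
    apply div_pos
    · apply Finset.sum_pos
      · intro i _
        exact Real.sqrt_pos.mpr (mul_pos (ho i) (ha i))
      · exact Finset.univ_nonempty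
    · have : (0 : ℝ) ≤ ∑ i, (din i : ℝ) := Finset.sum_nonneg fun i _ => (ha i).le
      linarith
  have hs : ∀ i, 0 < Real.sqrt ((dout i : ℝ) / (din i : ℝ)) :=
    fun i => Real.sqrt_pos.mpr (div_pos (ho i) (ha i))
  have hs2 : ∀ i, (dout i : ℝ) = din i * Real.sqrt ((dout i : ℝ) / (din i : ℝ)) ^ 2 := by
    intro i
    rw [Real.sq_sqrt (div_pos (ho i) (ha i)).le, mul_div_cancel₀ _ (ha i).ne']
  have hs3 : ∀ i, Real.sqrt ((dout i : ℝ) * din i)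
      = din i * Real.sqrt ((dout i : ℝ) / (din i : ℝ)) := by
    intro i
    rw [Real.sqrt_eq_iff_mul_self_eq_of_pos (mul_pos (ha i) (hs i))]
    have := hs2 i
    linear_combination (-(din i : ℝ)) * this
  have hbsum : (b : ℝ) ≤ ∑ i, drel n dout din hstar i := by
    obtain ⟨x, _, hx⟩ := hstar_mem
    unfold hfun at hx
    set S := Finset.univ.filter (fun i : Fin n => x ^ 2 ≤ (dout i : ℝ) / (din i : ℝ))
    have hden : (0 : ℝ) < b + ∑ i ∈ S, (din i : ℝ) := by
      have : (0 : ℝ) ≤ ∑ i ∈ S, (din i : ℝ) := Finset.sum_nonneg fun i _ => (ha i).le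
      linarith
    rw [div_eq_iff hden.ne'] at hx
    have h1 : ∑ i ∈ S, (din i : ℝ) * (Real.sqrt ((dout i : ℝ) / (din i : ℝ)) / hstar - 1) = b := by
      have : ∀ i ∈ S, (din i : ℝ) * (Real.sqrt ((dout i : ℝ) / (din i : ℝ)) / hstar - 1)
          = Real.sqrt ((dout i : ℝ) * din i) / hstar - din i := by
        intro i _
        rw [hs3]; ring
      rw [Finset.sum_congr rfl this, Finset.sum_sub_distrib, ← Finset.sum_div, hx]
      field_simp
      ring
    calc (b : ℝ) = _ := h1.symm
      _ ≤ ∑ i ∈ S, drel n dout din hstar i := by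
        apply Finset.sum_le_sum
        intro i _
        exact mul_le_mul_of_nonneg_left (le_max_left _ _) (ha i).le
      _ ≤ ∑ i, drel n dout din hstar i := by
        apply Finset.sum_le_sum_of_subset_of_nonneg (Finset.subset_univ _)
        intro i _ _
        exact mul_nonneg (ha i).le (le_max_right _ _)
  have key : ∑ i, (din i : ℝ) / (din i + drel n dout din hstar i) * dout i
      ≤ ∑ i, (din i : ℝ) / (din i + d i) * dout i := by
    have h1 : ∑ i, (din i : ℝ) / (din i + drel n dout din hstar i) * dout i
      ≤ ∑ i, ((din i : ℝ) / (din i + d i) * dout i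
          + hstar ^ 2 * (d i - drel n dout din hstar i)) := by
      apply Finset.sum_le_sum
      intro i _
      have h := term_ineq (din i) _ hstar (d i) (ha i) (hs i) hH (hd i)
      rw [← hs2 i] at h
      exact h
    rw [Finset.sum_add_distrib, ← Finset.mul_sum, Finset.sum_sub_distrib] at h1
    have h2 : hstar ^ 2 * (∑ i, d i - ∑ i, drel n dout din hstar i) ≤ 0 :=
      mul_nonpos_of_nonneg_of_nonpos (by positivity) (by linarith)
    linarith
  unfold ptilde
  simp only [← mul_div_assoc]
  rw [← Finset.sum_div, ← Finset.sum_div]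
  exact div_le_div_of_nonneg_right key (Finset.sum_nonneg fun i _ => (ho i).le)
end

section
/- The relaxed solution exhausts the budget exactly: Σ_{i=1}^n d_n^rel(i) = b_n. -/
open scoped Classical

theorem key_le (n b : ℕ) (hb : 0 < b)
    (dout din : Fin n → ℕ) (hdin : ∀ i, 0 < din i) (x : ℝ) (hx : 0 ≤ x) :
    hfun n dout din b x =
      (∑ i, if x ≤ Real.sqrt ((dout i : ℝ) / (din i : ℝ)) then
        (din i : ℝ) * Real.sqrt ((dout i : ℝ) / (din i : ℝ)) else 0) /
      ((b : ℝ) + ∑ i, if x ≤ Real.sqrt ((dout i : ℝ) / (din i : ℝ)) then (din i : ℝ) else 0) := by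
  have e : ∀ i, Real.sqrt ((dout i : ℝ) * (din i : ℝ))
      = (din i : ℝ) * Real.sqrt ((dout i : ℝ) / (din i : ℝ)) := by
    intro i
    have hd : (0 : ℝ) < din i := by exact_mod_cast hdin i
    have h2 : (dout i : ℝ) * (din i : ℝ) = (din i : ℝ) ^ 2 * ((dout i : ℝ) / (din i : ℝ)) := by
      field_simp
    rw [h2, Real.sqrt_mul (by positivity), Real.sqrt_sq hd.le]
  have c : ∀ i, (x ^ 2 ≤ (dout i : ℝ) / (din i : ℝ))
      ↔ x ≤ Real.sqrt ((dout i : ℝ) / (din i : ℝ)) :=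
    fun i => (Real.le_sqrt hx (by positivity)).symm
  unfold hfun
  simp only [Finset.sum_filter, e, c]

/-- the relaxed solution exhausts the budget exactly: `Σ_i d_n^rel(i) = b_n`. -/
theorem stmt4 (n b : ℕ) (hn : 0 < n) (hb : 0 < b)
    (dout din : Fin n → ℕ) (hdout : ∀ i, 0 < dout i) (hdin : ∀ i, 0 < din i)
    (hstar : ℝ) (hstar_mem : ∃ x : ℝ, 0 ≤ x ∧ hfun n dout din b x = hstar)
    (hstar_max : ∀ x : ℝ, 0 ≤ x → hfun n dout din b x ≤ hstar) :
    ∑ i, drel n dout din hstar i = (b : ℝ) := by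
  have hb' : (0 : ℝ) < b := by exact_mod_cast hb
  have hd : ∀ i, (0 : ℝ) < din i := fun i => by exact_mod_cast hdin i
  have ho : ∀ i, (0 : ℝ) < dout i := fun i => by exact_mod_cast hdout i
  have key := key_le n b hb dout din hdin
  unfold drel
  have hs : ∀ i, 0 < Real.sqrt ((dout i : ℝ) / (din i : ℝ)) :=
    fun i => Real.sqrt_pos.2 (div_pos (ho i) (hd i))
  generalize hsdef : (fun i => Real.sqrt ((dout i : ℝ) / (din i : ℝ))) = s at *
  have hsi : ∀ i, Real.sqrt ((dout i : ℝ) / (din i : ℝ)) = s i := fun i => congrFun hsdef i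
  simp only [hsi] at *
  have hden : ∀ x, 0 < (b : ℝ) + ∑ i, if x ≤ s i then (din i : ℝ) else 0 := by
    intro x
    have : 0 ≤ ∑ i, if x ≤ s i then (din i : ℝ) else 0 :=
      Finset.sum_nonneg fun i _ => by split_ifs <;> simp
    linarith
  have hpos : 0 < hstar := by
    refine lt_of_lt_of_le ?_ (hstar_max 0 le_rfl)
    rw [key 0 le_rfl]
    refine div_pos ?_ (hden 0)
    refine Finset.sum_pos (fun i _ => ?_) ⟨⟨0, hn⟩, Finset.mem_univ _⟩
    rw [if_pos (hs i).le]
    exact mul_pos (hd i) (hs i)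
  have hsum : ∀ x, (∑ i, if x ≤ s i then (din i : ℝ) * (s i - hstar) else 0)
      = (∑ i, if x ≤ s i then (din i : ℝ) * s i else 0)
        - hstar * ∑ i, if x ≤ s i then (din i : ℝ) else 0 := by
    intro x
    rw [Finset.mul_sum, ← Finset.sum_sub_distrib]
    refine Finset.sum_congr rfl fun i _ => ?_
    split_ifs <;> ring
  have hmain : ∑ i, (din i : ℝ) * max (s i - hstar) 0 = hstar * b := by
    apply le_antisymm
    · have h1 := hstar_max hstar hpos.le
      rw [key _ hpos.le, div_le_iff₀ (hden _)] at h1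
      have h2 := hsum hstar
      have h3 : ∑ i, (din i : ℝ) * max (s i - hstar) 0
          = ∑ i, if hstar ≤ s i then (din i : ℝ) * (s i - hstar) else 0 := by
        refine Finset.sum_congr rfl fun i _ => ?_
        split_ifs with h
        · rw [max_eq_left (by linarith)]
        · rw [max_eq_right (by linarith), mul_zero]
      linarith
    · obtain ⟨x, hx, hxe⟩ := hstar_mem
      rw [key _ hx, div_eq_iff (hden _).ne'] at hxe
      have h2 := hsum x
      have h3 : (∑ i, if x ≤ s i then (din i : ℝ) * (s i - hstar) else 0)
          ≤ ∑ i, (din i : ℝ) * max (s i - hstar) 0 := by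
        refine Finset.sum_le_sum fun i _ => ?_
        split_ifs with h
        · exact mul_le_mul_of_nonneg_left (le_max_left _ _) (hd i).le
        · exact mul_nonneg (hd i).le (le_max_right _ _)
      linarith
  have hfin : ∑ i, (din i : ℝ) * max (s i - hstar) 0
      = hstar * ∑ i, (din i : ℝ) * max (s i / hstar - 1) 0 := by
    rw [Finset.mul_sum]
    refine Finset.sum_congr rfl fun i _ => ?_
    have : max (s i - hstar) 0 = hstar * max (s i / hstar - 1) 0 := by
      rw [mul_max_of_nonneg _ _ hpos.le, mul_zero, mul_sub, mul_div_cancel₀ _ hpos.ne', mul_one]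
    rw [this]; ring
  rw [hfin] at hmain
  exact mul_left_cancel₀ hpos.ne' hmain
end

section
/- For every x ∈ [0,∞), h(x) ≤ h(h(x)); consequently, the maximal value h* = max_{x ≥ 0} h(x) is a fixed point of h, i.e. h* = h(h*). -/
open scoped Classical

/-- for every `x ≥ 0`, `h(x) ≤ h(h(x))`; consequently the maximal value
`h* = max_{x ≥ 0} h(x)` is a fixed point of `h`, i.e. `h* = h(h*)`. -/
theorem stmt5 (n b : ℕ) (hn : 0 < n) (hb : 0 < b)
    (dout din : Fin n → ℕ) (hdout : ∀ i, 0 < dout i) (hdin : ∀ i, 0 < din i)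
    (hstar : ℝ) (hstar_mem : ∃ x : ℝ, 0 ≤ x ∧ hfun n dout din b x = hstar)
    (hstar_max : ∀ x : ℝ, 0 ≤ x → hfun n dout din b x ≤ hstar) :
    (∀ x : ℝ, 0 ≤ x → hfun n dout din b x ≤ hfun n dout din b (hfun n dout din b x))
    ∧ hstar = hfun n dout din b hstar := by
  have hb' : (0 : ℝ) < b := by exact_mod_cast hb
  have den : ∀ y : ℝ, 0 < (b : ℝ) +
      ∑ i ∈ Finset.univ.filter (fun i : Fin n => y ^ 2 ≤ (dout i : ℝ) / (din i : ℝ)),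
        (din i : ℝ) := fun y =>
    add_pos_of_pos_of_nonneg hb' (Finset.sum_nonneg fun i _ => Nat.cast_nonneg _)
  have nonneg : ∀ y : ℝ, 0 ≤ hfun n dout din b y := fun y =>
    div_nonneg (Finset.sum_nonneg fun i _ => Real.sqrt_nonneg _) (den y).le
  have key : ∀ c : ℝ, 0 ≤ c → ∀ i, c ^ 2 ≤ (dout i : ℝ) / (din i : ℝ) ↔
      0 ≤ Real.sqrt ((dout i : ℝ) * (din i : ℝ)) - c * din i := by
    intro c hc i
    have hd : (0 : ℝ) < din i := by exact_mod_cast hdin i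
    rw [sub_nonneg, Real.le_sqrt (by positivity), le_div_iff₀ hd, mul_pow, sq (din i : ℝ),
      ← mul_assoc, mul_le_mul_iff_left₀ hd]
    positivity
  have main : ∀ x : ℝ, 0 ≤ x →
      hfun n dout din b x ≤ hfun n dout din b (hfun n dout din b x) := by
    intro x _
    have hc := nonneg x
    generalize hx' : hfun n dout din b x = c at hc ⊢
    have hx := hx'.symm
    unfold hfun at hx ⊢
    rw [eq_div_iff (den x).ne'] at hx
    rw [le_div_iff₀ (den c)]
    have hle : ∑ i ∈ Finset.univ.filter (fun i : Fin n => x ^ 2 ≤ (dout i : ℝ) / (din i : ℝ)),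
          (Real.sqrt ((dout i : ℝ) * (din i : ℝ)) - c * din i) ≤
        ∑ i ∈ Finset.univ.filter (fun i : Fin n => c ^ 2 ≤ (dout i : ℝ) / (din i : ℝ)),
          (Real.sqrt ((dout i : ℝ) * (din i : ℝ)) - c * din i) := by
      rw [Finset.sum_filter, Finset.sum_filter]
      refine Finset.sum_le_sum fun i _ => ?_
      have hk := key c hc i
      split_ifs with h1 h2 h2
      · exact le_rfl
      · exact (not_le.mp fun h => h2 (hk.mpr h)).le
      · exact hk.mp h2
      · exact le_rfl
    rw [Finset.sum_sub_distrib, Finset.sum_sub_distrib, ← Finset.mul_sum, ← Finset.mul_sum] at hle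
    rw [mul_add] at hx ⊢
    linarith
  refine ⟨main, ?_⟩
  obtain ⟨x, hx0, hx⟩ := hstar_mem
  have h1 := main x hx0
  rw [hx] at h1
  exact le_antisymm h1 (hstar_max _ (hx ▸ nonneg x))
end

section
/- The function g_n is self-bounding: for every w ∈ [n]^{b_n} and every i ∈ {1,…,b_n}, one has 0 < g_n(w) − g_{n,−i}(w_{−i}) ≤ 1, and moreover Σ_{i=1}^{b_n} ( g_n(w) − g_{n,−i}(w_{−i}) ) ≤ g_n(w). Here w_{−i} is w with its i-th coordinate deleted, and g_{n,−i}(w_{−i}) = (1/r̄)·Σ_{j≠i} d_out(w_j)/(d_in^A(w_j) + Σ_{k≠i} 1(w_k = w_j)). -/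
open scoped Classical

/-- `g_n(w) = (1/r̄)·Σ_j d_out(w_j)/(d_in^A(w_j) + Σ_k 1(w_k = w_j))`. -/
noncomputable def gfun (n b : ℕ) (dout din : Fin n → ℕ) (rbar : ℝ) (w : Fin b → Fin n) : ℝ :=
  (1 / rbar) * ∑ j, (dout (w j) : ℝ) /
    ((din (w j) : ℝ) + ∑ k, if w k = w j then (1 : ℝ) else 0)

/-- `g_{n,−i}(w_{−i}) = (1/r̄)·Σ_{j≠i} d_out(w_j)/(d_in^A(w_j) + Σ_{k≠i} 1(w_k = w_j))`. -/
noncomputable def gminus (n b : ℕ) (dout din : Fin n → ℕ) (rbar : ℝ) (w : Fin b → Fin n)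
    (i : Fin b) : ℝ :=
  (1 / rbar) * ∑ j ∈ Finset.univ.erase i, (dout (w j) : ℝ) /
    ((din (w j) : ℝ) + ∑ k ∈ Finset.univ.erase i, if w k = w j then (1 : ℝ) else 0)

/-- The increment of the unnormalized sum when coordinate `i` is added. -/
theorem diff_aux (n b : ℕ) (dout din : Fin n → ℕ) (hdin : ∀ i, 0 < din i)
    (rbar : ℝ) (w : Fin b → Fin n) (i : Fin b) :
    ∃ m : ℝ, 0 ≤ m ∧ (∑ k, if w k = w i then (1 : ℝ) else 0) = 1 + m ∧
      gfun n b dout din rbar w - gminus n b dout din rbar w i =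
      (1 / rbar) * ((dout (w i) : ℝ) / ((din (w i) : ℝ) + (1 + m)) *
        ((din (w i) : ℝ) / ((din (w i) : ℝ) + m))) := by
  have hsplit : ∀ f : Fin b → ℝ, ∑ k, f k = f i + ∑ k ∈ Finset.univ.erase i, f k :=
    fun f => (Finset.add_sum_erase _ f (Finset.mem_univ i)).symm
  set m : ℝ := ∑ k ∈ Finset.univ.erase i, if w k = w i then (1 : ℝ) else 0 with hm
  have hm0 : 0 ≤ m := Finset.sum_nonneg (fun k _ => by split_ifs <;> norm_num)
  have hc : (∑ k, if w k = w i then (1 : ℝ) else 0) = 1 + m := by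
    rw [hsplit]; simp [hm]
  have hd : (0 : ℝ) < din (w i) := by exact_mod_cast hdin (w i)
  refine ⟨m, hm0, hc, ?_⟩
  unfold gfun gminus
  rw [← mul_sub, hsplit, add_sub_assoc, ← Finset.sum_sub_distrib, hc]
  have key : ∀ j ∈ Finset.univ.erase i,
      ((dout (w j) : ℝ) / ((din (w j) : ℝ) + ∑ k, if w k = w j then (1 : ℝ) else 0) -
       (dout (w j) : ℝ) / ((din (w j) : ℝ) +
          ∑ k ∈ Finset.univ.erase i, if w k = w j then (1 : ℝ) else 0)) =
      (if w j = w i then (1 : ℝ) else 0) *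
        ((dout (w i) : ℝ) / ((din (w i) : ℝ) + (1 + m)) -
          (dout (w i) : ℝ) / ((din (w i) : ℝ) + m)) := by
    intro j _
    by_cases h : w j = w i
    · rw [h, hc, ← hm]; simp
    · rw [hsplit, if_neg (fun h' => h h'.symm), if_neg h]; simp
  rw [Finset.sum_congr rfl key, ← Finset.sum_mul, ← hm]
  congr 1
  have h1 : (din (w i) : ℝ) + m ≠ 0 := by positivity
  have h2 : (din (w i) : ℝ) + (1 + m) ≠ 0 := by positivity
  field_simp
  ring

/-- `g_n` is self-bounding: for every `w` and every coordinate `i`,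
`0 < g_n(w) − g_{n,−i}(w_{−i}) ≤ 1`, and `Σ_i (g_n(w) − g_{n,−i}(w_{−i})) ≤ g_n(w)`. -/
theorem stmt8 (n b : ℕ) (hn : 0 < n) (hb : 0 < b)
    (dout din : Fin n → ℕ) (hdout : ∀ i, 0 < dout i) (hdin : ∀ i, 0 < din i)
    (rbar : ℝ) (hrbar_mem : ∃ j : Fin n, rbar = (dout j : ℝ) / (din j : ℝ))
    (hrbar_max : ∀ j : Fin n, (dout j : ℝ) / (din j : ℝ) ≤ rbar)
    (w : Fin b → Fin n) :
    (∀ i : Fin b,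
        0 < gfun n b dout din rbar w - gminus n b dout din rbar w i
        ∧ gfun n b dout din rbar w - gminus n b dout din rbar w i ≤ 1)
    ∧ ∑ i, (gfun n b dout din rbar w - gminus n b dout din rbar w i)
        ≤ gfun n b dout din rbar w := by
  have hr : 0 < rbar := by
    obtain ⟨j, rfl⟩ := hrbar_mem
    have h1 : (0 : ℝ) < dout j := by exact_mod_cast hdout j
    have h2 : (0 : ℝ) < din j := by exact_mod_cast hdin j
    positivity
  have hle : ∀ i : Fin b, gfun n b dout din rbar w - gminus n b dout din rbar w i ≤
      (1 / rbar) * ((dout (w i) : ℝ) /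
        ((din (w i) : ℝ) + ∑ k, if w k = w i then (1 : ℝ) else 0)) := by
    intro i
    obtain ⟨m, hm, hc, he⟩ := diff_aux n b dout din hdin rbar w i
    rw [he, hc]
    have hd : (0 : ℝ) < din (w i) := by exact_mod_cast hdin (w i)
    apply mul_le_mul_of_nonneg_left _ (by positivity)
    apply mul_le_of_le_one_right (by positivity)
    rw [div_le_one (by positivity)]
    linarith
  refine ⟨fun i => ⟨?_, (hle i).trans ?_⟩, ?_⟩
  · obtain ⟨m, hm, hc, he⟩ := diff_aux n b dout din hdin rbar w i
    rw [he]
    have hd : (0 : ℝ) < din (w i) := by exact_mod_cast hdin (w i)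
    have ho : (0 : ℝ) < dout (w i) := by exact_mod_cast hdout (w i)
    positivity
  · obtain ⟨m, hm, hc, he⟩ := diff_aux n b dout din hdin rbar w i
    rw [hc, one_div, inv_mul_le_iff₀ hr, mul_one]
    refine le_trans ?_ (hrbar_max (w i))
    have hd : (0 : ℝ) < din (w i) := by exact_mod_cast hdin (w i)
    apply div_le_div_of_nonneg_left (by positivity) hd
    linarith
  · refine (Finset.sum_le_sum (fun i _ => hle i)).trans ?_
    rw [← Finset.mul_sum]
    exact le_of_eq rfl
end

section
/- For every agent i and every horizon T ∈ ℕ, the belief θ_T(i) is sandwiched between explicit perturbations of ϑ_T(i): ϑ_T(i) / (1 + (ᾱ+β̄)/((1−η)T)) ≤ θ_T(i) ≤ ϑ_T(i) + ᾱ/((1−η)T). In particular, for any ε > 0 there exists N such that whenever (1−η)T ≥ N, |θ_T(i) − ϑ_T(i)| < ε uniformly over all i and all admissible signal sequences and priors. -/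
open scoped Matrix

lemma vecMul_bound {V : Type} [Fintype V] [DecidableEq V] (Q : Matrix V V ℝ)
    (hn : ∀ i j, 0 ≤ Q i j) (hc : ∀ j, ∑ i, Q i j = 1) (c : ℝ) (f : ℕ → V → ℝ)
    (h0 : ∀ i, 0 ≤ f 0 i ∧ f 0 i ≤ c) (hs : ∀ t, f (t + 1) = Matrix.vecMul (f t) Q) :
    ∀ t i, 0 ≤ f t i ∧ f t i ≤ c := by
  intro t
  induction t with
  | zero => exact h0
  | succ t ih =>
    intro i
    rw [hs t]
    simp only [Matrix.vecMul, dotProduct]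
    refine ⟨Finset.sum_nonneg fun j _ => mul_nonneg (ih j).1 (hn j i), ?_⟩
    calc ∑ j, f t j * Q j i ≤ ∑ j, c * Q j i :=
          Finset.sum_le_sum fun j _ => mul_le_mul_of_nonneg_right (ih j).2 (hn j i)
      _ = c := by rw [← Finset.mul_sum, hc, mul_one]

/-- All the estimates on the accumulated counts. -/
lemma key_bounds {V : Type} [Fintype V] [DecidableEq V] (Q : Matrix V V ℝ)
    (hn : ∀ i j, 0 ≤ Q i j) (hc : ∀ j, ∑ i, Q i j = 1) (k a b : ℝ)
    (α β s : ℕ → V → ℝ)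
    (hα : ∀ i, 0 ≤ α 0 i ∧ α 0 i ≤ a) (hβ : ∀ i, 0 ≤ β 0 i ∧ β 0 i ≤ b)
    (hs : ∀ t i, 0 ≤ s t i ∧ s t i ≤ 1)
    (hαs : ∀ t i, α (t + 1) i = k * s (t + 1) i + Matrix.vecMul (α t) Q i)
    (hβs : ∀ t i, β (t + 1) i = k * (1 - s (t + 1) i) + Matrix.vecMul (β t) Q i)
    (T : ℕ) (i : V) :
    ∃ S : ℝ, S = ∑ t ∈ Finset.range T, Matrix.vecMul (s (T - t)) (Q ^ t) i ∧
      0 ≤ S ∧ S ≤ T ∧ k * S ≤ α T i ∧ α T i ≤ k * S + a ∧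
      k * T ≤ α T i + β T i ∧ α T i + β T i ≤ k * T + (a + b) := by
  have hone : Matrix.vecMul (fun _ => (1 : ℝ)) Q = fun _ => 1 := by
    funext j
    simp [Matrix.vecMul, dotProduct, hc]
  have hterm : ∀ r t j, 0 ≤ Matrix.vecMul (s r) (Q ^ t) j ∧
      Matrix.vecMul (s r) (Q ^ t) j ≤ 1 := fun r =>
    vecMul_bound Q hn hc 1 (fun t => Matrix.vecMul (s r) (Q ^ t))
      (by simpa using hs r) (fun t => by simp [pow_succ, Matrix.vecMul_vecMul])
  let S : ℕ → V → ℝ := fun T => ∑ t ∈ Finset.range T, Matrix.vecMul (s (T - t)) (Q ^ t)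
  have hS : ∀ t, S (t + 1) = s (t + 1) + Matrix.vecMul (S t) Q := by
    intro t
    simp only [S]
    rw [Finset.sum_range_succ', Matrix.sum_vecMul, add_comm]
    simp [pow_succ, Matrix.vecMul_vecMul]
  have hα' : ∀ t, α (t + 1) = k • s (t + 1) + Matrix.vecMul (α t) Q := fun t => by
    funext j; simp [hαs]
  have hβ' : ∀ t, β (t + 1) = k • ((fun _ => 1) - s (t + 1)) + Matrix.vecMul (β t) Q :=
    fun t => by funext j; simp [hβs]
  have h1 := vecMul_bound Q hn hc a (fun t => α t - k • S t) (by simpa [S] using hα)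
    (fun t => by
      simp only [hα', hS, Matrix.sub_vecMul, Matrix.smul_vecMul, smul_add]; abel) T i
  have h2 := vecMul_bound Q hn hc (a + b)
    (fun t => α t + β t - (k * (t : ℝ)) • (fun _ => (1 : ℝ)))
    (fun j => by
      have := hα j
      have := hβ j
      simp; constructor <;> linarith)
    (fun t => by
      simp only [hα', hβ', Matrix.sub_vecMul, Matrix.add_vecMul, Matrix.smul_vecMul, hone]
      funext j
      simp
      ring) T i
  simp at h1 h2
  refine ⟨S T i, by simp [S], ?_, ?_, ?_, ?_, ?_, ?_⟩
  · simp only [S, Finset.sum_apply]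
    exact Finset.sum_nonneg fun t _ => (hterm _ _ _).1
  · simp only [S, Finset.sum_apply]
    refine (Finset.sum_le_sum fun t _ => (hterm (T - t) t i).2).trans ?_
    simp
  all_goals linarith [h1.1, h1.2, h2.1, h2.2]

lemma sandwich (k a b S T x d : ℝ) (hk : 0 < k) (hT : 0 < T) (ha : 0 < a) (hb : 0 < b)
    (hS : 0 ≤ S) (h1 : k * S ≤ x) (h2 : x ≤ k * S + a)
    (h3 : k * T ≤ d) (h4 : d ≤ k * T + (a + b)) :
    S / T / (1 + (a + b) / (k * T)) ≤ x / d ∧ x / d ≤ S / T + a / (k * T) := by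
  have hkT : 0 < k * T := by positivity
  have hx : 0 ≤ x := le_trans (by positivity) h1
  constructor
  · have : S / T / (1 + (a + b) / (k * T)) = k * S / (k * T + (a + b)) := by
      field_simp
    rw [this]
    exact div_le_div₀ hx h1 (by linarith) h4
  · have : S / T + a / (k * T) = (k * S + a) / (k * T) := by
      field_simp
    rw [this]
    exact div_le_div₀ (by linarith) h2 hkT h3

/-- the belief `θ_T(i) = α_T(i)/(α_T(i)+β_T(i))` is sandwiched between explicit
perturbations of `ϑ_T(i) = (1/T)·Σ_{t=0}^{T−1} s_{T−t} Q^t e_i^⊤`: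
`ϑ_T(i)/(1 + (ᾱ+β̄)/((1−η)T)) ≤ θ_T(i) ≤ ϑ_T(i) + ᾱ/((1−η)T)`; in particular, for any
`ε > 0` there is `N` such that whenever `(1−η)T ≥ N`, `|θ_T(i) − ϑ_T(i)| < ε` uniformly
over all `i`, all admissible signal sequences, and all admissible priors. -/
theorem stmt10 (V : Type) [Fintype V] [DecidableEq V]
    (η : ℝ) (hη : 0 < η ∧ η < 1)
    (Pm : Matrix V V ℝ) (hPnn : ∀ i j, 0 ≤ Pm i j) (hPcol : ∀ j, ∑ i, Pm i j = 1)
    (abar bbar : ℝ) (habar : 0 < abar) (hbbar : 0 < bbar) :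
    (∀ α β s : ℕ → V → ℝ,
        (∀ i, 0 ≤ α 0 i ∧ α 0 i ≤ abar) →
        (∀ i, 0 ≤ β 0 i ∧ β 0 i ≤ bbar) →
        (∀ t i, 0 ≤ s t i ∧ s t i ≤ 1) →
        (∀ t i, α (t + 1) i = (1 - η) * s (t + 1) i +
            Matrix.vecMul (α t) ((1 - η) • (1 : Matrix V V ℝ) + η • Pm) i) →
        (∀ t i, β (t + 1) i = (1 - η) * (1 - s (t + 1) i) +
            Matrix.vecMul (β t) ((1 - η) • (1 : Matrix V V ℝ) + η • Pm) i) →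
        ∀ T : ℕ, 0 < T → ∀ i : V,
          ((∑ t ∈ Finset.range T,
                Matrix.vecMul (s (T - t)) (((1 - η) • (1 : Matrix V V ℝ) + η • Pm) ^ t) i) / T)
              / (1 + (abar + bbar) / ((1 - η) * T))
            ≤ α T i / (α T i + β T i)
          ∧ α T i / (α T i + β T i)
            ≤ ((∑ t ∈ Finset.range T,
                Matrix.vecMul (s (T - t)) (((1 - η) • (1 : Matrix V V ℝ) + η • Pm) ^ t) i) / T)
              + abar / ((1 - η) * T))
    ∧ (∀ ε : ℝ, 0 < ε → ∃ N : ℝ, ∀ α β s : ℕ → V → ℝ,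
        (∀ i, 0 ≤ α 0 i ∧ α 0 i ≤ abar) →
        (∀ i, 0 ≤ β 0 i ∧ β 0 i ≤ bbar) →
        (∀ t i, 0 ≤ s t i ∧ s t i ≤ 1) →
        (∀ t i, α (t + 1) i = (1 - η) * s (t + 1) i +
            Matrix.vecMul (α t) ((1 - η) • (1 : Matrix V V ℝ) + η • Pm) i) →
        (∀ t i, β (t + 1) i = (1 - η) * (1 - s (t + 1) i) +
            Matrix.vecMul (β t) ((1 - η) • (1 : Matrix V V ℝ) + η • Pm) i) →
        ∀ T : ℕ, 0 < T → N ≤ (1 - η) * T → ∀ i : V,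
          |α T i / (α T i + β T i)
            - (∑ t ∈ Finset.range T,
                Matrix.vecMul (s (T - t)) (((1 - η) • (1 : Matrix V V ℝ) + η • Pm) ^ t) i) / T|
          < ε) := by
  have hk : 0 < 1 - η := by linarith [hη.2]
  have hn : ∀ i j, 0 ≤ ((1 - η) • (1 : Matrix V V ℝ) + η • Pm) i j := by
    intro i j
    have h1 : 0 ≤ η * Pm i j := mul_nonneg hη.1.le (hPnn i j)
    by_cases h : i = j
    · subst h; simp; linarith
    · simpa [Matrix.one_apply, h] using h1
  have hc : ∀ j, ∑ i, ((1 - η) • (1 : Matrix V V ℝ) + η • Pm) i j = 1 := by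
    intro j
    simp [Finset.sum_add_distrib, ← Finset.mul_sum, hPcol, Matrix.one_apply]
  generalize (1 - η) • (1 : Matrix V V ℝ) + η • Pm = Q at *
  constructor
  · intro α β s hα hβ hs hαs hβs T hT i
    obtain ⟨S, hSe, hS0, hS1, h1, h2, h3, h4⟩ :=
      key_bounds Q hn hc _ _ _ α β s hα hβ hs hαs hβs T i
    rw [← hSe]
    exact sandwich _ _ _ _ _ _ _ hk (by exact_mod_cast hT) habar hbbar hS0 h1 h2 h3 h4
  · intro ε hε
    refine ⟨(abar + bbar) / ε + 1, ?_⟩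
    intro α β s hα hβ hs hαs hβs T hT hN i
    obtain ⟨S, hSe, hS0, hS1, h1, h2, h3, h4⟩ :=
      key_bounds Q hn hc _ _ _ α β s hα hβ hs hαs hβs T i
    rw [← hSe]
    have hT' : (0 : ℝ) < T := by exact_mod_cast hT
    obtain ⟨hl, hu⟩ := sandwich _ _ _ _ _ _ _ hk hT' habar hbbar hS0 h1 h2 h3 h4
    have hM : 0 < (1 - η) * T := by positivity
    have hx : (abar + bbar) / ((1 - η) * T) < ε := by
      rw [div_lt_iff₀ hM, mul_comm, ← div_lt_iff₀ hε]
      linarith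
    have hx0 : 0 < (abar + bbar) / ((1 - η) * T) := by positivity
    have ha : abar / ((1 - η) * T) ≤ (abar + bbar) / ((1 - η) * T) := by
      gcongr; linarith
    have hv : S / T ≤ 1 := (div_le_one hT').2 hS1
    have hv0 : 0 ≤ S / T := by positivity
    generalize (abar + bbar) / ((1 - η) * T) = x at *
    have hlow : S / T - x ≤ S / T / (1 + x) := by
      rw [le_div_iff₀ (by linarith)]
      nlinarith [mul_nonneg hx0.le (sub_nonneg.2 hv), sq_nonneg x]
    rw [abs_lt]
    constructor <;> linarith
end

section
/- For every T ∈ ℕ, η ∈ (0,1), and x ∈ (0,1), Σ_{l=1}^{T−1} ( Σ_{l'=l}^{T−1} u_{T,l'}·x^{l'−l} )² ≤ T / (η²·(1−x)²). -/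
/-- `u_{T,l} = Σ_{t=l}^{T−1} C(t,l)·η^l·(1−η)^{t−l}`. -/
noncomputable def uTl (T l : ℕ) (η : ℝ) : ℝ :=
  ∑ t ∈ Finset.Icc l (T - 1), (t.choose l : ℝ) * η ^ l * (1 - η) ^ (t - l)

lemma icc_sum_eq (f : ℕ → ℝ) (l N : ℕ) :
    ∑ t ∈ Finset.Icc l N, f t = ∑ n ∈ Finset.range (N + 1 - l), f (l + n) := by
  rw [← Finset.sum_Ico_eq_sum_range]
  congr 1

lemma uTl_le (T l : ℕ) (η : ℝ) (h0 : 0 < η) (h1 : η < 1) : uTl T l η ≤ 1 / η := by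
  unfold uTl
  rw [icc_sum_eq]
  have hr : ‖(1 - η : ℝ)‖ < 1 := by
    rw [Real.norm_eq_abs, abs_lt]; constructor <;> linarith
  have hs := hasSum_choose_mul_geometric_of_norm_lt_one l hr
  have hle := sum_le_hasSum (Finset.range (T - 1 + 1 - l)) (fun n _ => by
    have : 0 ≤ 1 - η := by linarith
    positivity) hs
  calc _ = η ^ l * ∑ n ∈ Finset.range (T - 1 + 1 - l), ((n + l).choose l : ℝ) * (1 - η) ^ n := by
        rw [Finset.mul_sum]
        refine Finset.sum_congr rfl fun n _ => ?_
        rw [Nat.add_sub_cancel_left, Nat.add_comm l n]; ring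
    _ ≤ η ^ l * (1 / (1 - (1 - η)) ^ (l + 1)) := by gcongr
    _ = 1 / η := by
        rw [sub_sub_cancel, pow_succ]; field_simp

lemma uTl_nonneg (T l : ℕ) (η : ℝ) (h0 : 0 < η) (h1 : η < 1) : 0 ≤ uTl T l η := by
  unfold uTl
  have : 0 ≤ 1 - η := by linarith
  positivity

/-- `Σ_{l=1}^{T−1} (Σ_{l'=l}^{T−1} u_{T,l'}·x^{l'−l})² ≤ T/(η²·(1−x)²)`. -/
theorem stmt12 (T : ℕ) (hT : 0 < T) (η x : ℝ)
    (hη : 0 < η ∧ η < 1) (hx : 0 < x ∧ x < 1) :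
    ∑ l ∈ Finset.Icc 1 (T - 1),
        (∑ l' ∈ Finset.Icc l (T - 1), uTl T l' η * x ^ (l' - l)) ^ 2
      ≤ (T : ℝ) / (η ^ 2 * (1 - x) ^ 2) := by
  obtain ⟨h0, h1⟩ := hη
  obtain ⟨hx0, hx1⟩ := hx
  have hx' : 0 < 1 - x := by linarith
  have key : ∀ l, ∑ l' ∈ Finset.Icc l (T - 1), uTl T l' η * x ^ (l' - l)
      ≤ 1 / η * (1 - x)⁻¹ := by
    intro l
    calc _ ≤ ∑ l' ∈ Finset.Icc l (T - 1), 1 / η * x ^ (l' - l) := by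
          refine Finset.sum_le_sum fun i _ => ?_
          exact mul_le_mul_of_nonneg_right (uTl_le T i η h0 h1) (by positivity)
      _ = 1 / η * ∑ n ∈ Finset.range (T - 1 + 1 - l), x ^ n := by
          rw [icc_sum_eq, Finset.mul_sum]
          simp
      _ ≤ _ := by
          refine mul_le_mul_of_nonneg_left ?_ (by positivity)
          exact sum_le_hasSum _ (fun n _ => by positivity)
            (hasSum_geometric_of_lt_one hx0.le hx1)
  calc _ ≤ ∑ l ∈ Finset.Icc 1 (T - 1), (1 / η * (1 - x)⁻¹) ^ 2 := by
        refine Finset.sum_le_sum fun l _ => ?_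
        refine pow_le_pow_left₀ (Finset.sum_nonneg fun i _ => ?_) (key l) 2
        exact mul_nonneg (uTl_nonneg T i η h0 h1) (by positivity)
    _ = ((T - 1 : ℕ) : ℝ) * (1 / η * (1 - x)⁻¹) ^ 2 := by simp
    _ ≤ (T : ℝ) * (1 / η * (1 - x)⁻¹) ^ 2 := by
        gcongr; omega
    _ = _ := by field_simp
end

section
/- Let ε > 0 and let I = {i ∈ [n] : r(i) ≥ ε·r̄}, assumed nonempty. Define d ∈ ℝⁿ by d(i) = d_out(i)·1(i ∈ I)·b_n / (Σ_{j∈I} d_out(j)). Then d has nonnegative entries, Σ_{i=1}^n d(i) = b_n, and (m_n/r̄)·(1 − p̃_n(d)) ≥ 1 / ( r̄/(Σ_{i∈I} d_out(i)) + 1/(ε·b_n) ). -/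
open scoped Classical

/-- with `I = {i : r(i) ≥ ε·r̄}` nonempty and
`d(i) = d_out(i)·1(i ∈ I)·b_n / Σ_{j∈I} d_out(j)`, the vector `d` is nonnegative,
sums to `b_n`, and `(m_n/r̄)·(1 − p̃_n(d)) ≥ 1/( r̄/Σ_{i∈I} d_out(i) + 1/(ε·b_n) )`. -/
theorem stmt18 (n b : ℕ) (hn : 0 < n) (hb : 0 < b)
    (dout din : Fin n → ℕ) (hdout : ∀ i, 0 < dout i) (hdin : ∀ i, 0 < din i)
    (rbar : ℝ) (hrbar_mem : ∃ j : Fin n, rbar = (dout j : ℝ) / (din j : ℝ))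
    (hrbar_max : ∀ j : Fin n, (dout j : ℝ) / (din j : ℝ) ≤ rbar)
    (ε : ℝ) (hε : 0 < ε)
    (I : Finset (Fin n))
    (hI : I = Finset.univ.filter (fun i : Fin n => ε * rbar ≤ (dout i : ℝ) / (din i : ℝ)))
    (hInonempty : I.Nonempty)
    (d : Fin n → ℝ)
    (hd : d = fun i => (dout i : ℝ) * (if i ∈ I then 1 else 0) * b / (∑ j ∈ I, (dout j : ℝ))) :
    (∀ i, 0 ≤ d i) ∧ (∑ i, d i = (b : ℝ)) ∧
      1 / (rbar / (∑ i ∈ I, (dout i : ℝ)) + 1 / (ε * b))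
        ≤ ((∑ i, (dout i : ℝ)) / rbar) * (1 - ptilde n dout din d) := by
  obtain ⟨j0, hj0⟩ := hrbar_mem
  have hdo : ∀ i, (0 : ℝ) < dout i := fun i => by exact_mod_cast hdout i
  have hdi : ∀ i, (0 : ℝ) < din i := fun i => by exact_mod_cast hdin i
  have hbR : (0 : ℝ) < b := by exact_mod_cast hb
  have hr : 0 < rbar := by rw [hj0]; exact div_pos (hdo _) (hdi _)
  have hS : 0 < ∑ j ∈ I, (dout j : ℝ) := Finset.sum_pos (fun i _ => hdo i) hInonempty
  have hM : 0 < ∑ j, (dout j : ℝ) := Finset.sum_pos (fun i _ => hdo i) ⟨j0, Finset.mem_univ _⟩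
  have hmem : ∀ i ∈ I, ε * rbar * din i ≤ dout i := by
    intro i hi
    rw [hI, Finset.mem_filter] at hi
    exact (le_div_iff₀ (hdi i)).1 hi.2
  have hsumI : ∑ i, (if i ∈ I then (dout i : ℝ) else 0) = ∑ j ∈ I, (dout j : ℝ) := by
    simp
  have hd' : ∀ i, d i = (if i ∈ I then (dout i : ℝ) else 0) * (b / ∑ j ∈ I, (dout j : ℝ)) := by
    intro i
    rw [hd]
    by_cases h : i ∈ I
    · simp only [h, if_true]; ring
    · simp [h]
  clear hd hI
  generalize hSdef : ∑ j ∈ I, (dout j : ℝ) = S at *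
  generalize hMdef : ∑ j, (dout j : ℝ) = M at *
  have hd0 : ∀ i, 0 ≤ d i := by
    intro i
    rw [hd']
    have := hdo i
    split_ifs <;> positivity
  refine ⟨hd0, ?_, ?_⟩
  · simp_rw [hd']
    rw [← Finset.sum_mul, hsumI]
    field_simp
  · have hterm : ∀ i, (if i ∈ I then (dout i : ℝ) else 0) * (ε * rbar * b / (S + ε * rbar * b))
        ≤ (dout i : ℝ) - (din i : ℝ) / (din i + d i) * dout i := by
      intro i
      have h1 := hdo i
      have h2 := hdi i
      by_cases h : i ∈ I
      · have h3 := hmem i h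
        have hdi' := hd' i
        simp only [h, if_true] at hdi' ⊢
        rw [hdi']
        have e : (dout i : ℝ) - (din i : ℝ) / (din i + dout i * (b / S)) * dout i
            = dout i * (dout i * b / (din i * S + dout i * b)) := by
          field_simp
          ring
        rw [e]
        apply mul_le_mul_of_nonneg_left _ h1.le
        rw [div_le_div_iff₀ (by positivity) (by positivity)]
        have := mul_le_mul_of_nonneg_left h3 (mul_pos hbR hS).le
        nlinarith
      · have hdi' := hd' i
        simp only [h, if_false, zero_mul] at hdi' ⊢
        rw [hdi', add_zero, div_self h2.ne']
        simp
    have hsum := Finset.sum_le_sum (fun i (_ : i ∈ Finset.univ) => hterm i)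
    rw [← Finset.sum_mul, hsumI, Finset.sum_sub_distrib, hMdef] at hsum
    have hp : ptilde n dout din d = (∑ i, (din i : ℝ) / (din i + d i) * dout i) / M := by
      unfold ptilde
      rw [hMdef, Finset.sum_div]
      exact Finset.sum_congr rfl fun i _ => by ring
    rw [hp]
    generalize (∑ i, (din i : ℝ) / (din i + d i) * dout i) = Q at *
    have e1 : M / rbar * (1 - Q / M) = (M - Q) / rbar := by field_simp
    have e2 : 1 / (rbar / S + 1 / (ε * b)) = S * (ε * rbar * b / (S + ε * rbar * b)) / rbar := by
      have : 0 < S + ε * rbar * b := by positivity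
      have : 0 < rbar / S + 1 / (ε * b) := by positivity
      field_simp
      ring
    rw [e1, e2]
    exact div_le_div_of_nonneg_right hsum hr.le
end
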